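/- For every n ≥ 1 and all (z, w, γ, λ) ∈ ℂ × ℂ × ℂ × ℂ^N at which L(z,λ) is defined (all theta-function denominators nonzero), the operator L(z,λ) maps the subspace ℂ^N ⊗ S^n(ℂ^N) of ℂ^N ⊗ (ℂ^N)^{⊗n} into itself, and maps the subspace ℂ^N ⊗ J_n(ℂ^N) into itself. -/

import Mathlib

open scoped BigOperators
open Complex Matrix Filter Topology

noncomputable section

namespace EllipticQG

/-- Jacobi's first theta function `θ(z) = -∑_{j ∈ ℤ+1/2} e^{πij²τ + 2πij(z+1/2)}`. -/
def theta (τ z : ℂ) : ℂ :=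
  -∑' j : ℤ, Complex.exp ((Real.pi : ℂ) * Complex.I * ((j : ℂ) + 1 / 2) ^ 2 * τ +
      2 * (Real.pi : ℂ) * Complex.I * ((j : ℂ) + 1 / 2) * (z + 1 / 2))

/-- `α(z,μ) = θ(z)θ(μ+γ)/(θ(z-γ)θ(μ))`. -/
def alphaF (τ γ z μ : ℂ) : ℂ :=
  theta τ z * theta τ (μ + γ) / (theta τ (z - γ) * theta τ μ)

/-- `β(z,μ) = -θ(z+μ)θ(γ)/(θ(z-γ)θ(μ))`. -/
def betaF (τ γ z μ : ℂ) : ℂ :=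
  -(theta τ (z + μ) * theta τ γ) / (theta τ (z - γ) * theta τ μ)

/-- The elliptic dynamical R-matrix of `E_{τ,γ/2}(gl_N)` on `ℂ^N ⊗ ℂ^N`.
Entry `((i,j),(k,l))` is the coefficient of `e_i ⊗ e_j` in `R (e_k ⊗ e_l)`. -/
def Rmat (N : ℕ) (τ γ z : ℂ) (lam : Fin N → ℂ) :
    Matrix (Fin N × Fin N) (Fin N × Fin N) ℂ := fun p q =>
  if p.1 = p.2 then (if q = p then 1 else 0)
  else (if q = p then alphaF τ γ z (lam p.1 - lam p.2) else 0) +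
    (if q = (p.2, p.1) then betaF τ γ z (lam p.1 - lam p.2) else 0)

/-- `λ - γ ∑_{c ∈ S} h^{(c)}` evaluated on the configuration `g` of basis indices. -/
def shiftL {n N : ℕ} (γ : ℂ) (lam : Fin N → ℂ) (S : Finset (Fin n)) (g : Fin n → Fin N) :
    Fin N → ℂ :=
  fun i => lam i - γ * ((S.filter fun c => g c = i).card : ℂ)

/-- `R(z, λ - γ ∑_{c∈S} h^{(c)})^{(a b)}` acting on `(ℂ^N)^{⊗ n}`. -/
def Rop (N n : ℕ) (τ γ z : ℂ) (lam : Fin N → ℂ) (S : Finset (Fin n)) (a b : Fin n) :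
    Matrix (Fin n → Fin N) (Fin n → Fin N) ℂ := fun f g =>
  if ∀ c, c ≠ a → c ≠ b → f c = g c then
    Rmat N τ γ z (shiftL γ lam S g) (f a, f b) (g a, g b)
  else 0

/-- The operators `W_n(z,λ)`, defined recursively:  `W_1 = 1` and
`W_{n+1}(z,λ) = R(z_1-z_2, λ-γ∑_{j=3}^{n+1}h^{(j)})^{(12)} ⋯ R(z_1-z_{n+1},λ)^{(1 n+1)}
  (1 ⊗ W_n(z_2,…,z_{n+1}, λ-γh^{(1)}))` (tensor factors indexed `0,…,n`). -/
def Wrec (N : ℕ) (τ γ : ℂ) : (n : ℕ) → (Fin n → ℂ) → (Fin N → ℂ) →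
    Matrix (Fin n → Fin N) (Fin n → Fin N) ℂ
  | 0, _, _ => 1
  | n + 1, z, lam =>
    (((List.finRange n).map fun j : Fin n =>
      Rop N (n + 1) τ γ (z 0 - z j.succ) lam
        (Finset.univ.filter fun c : Fin (n + 1) => j.succ < c) 0 j.succ).prod) *
      Matrix.of (fun f g : Fin (n + 1) → Fin N =>
        if f 0 = g 0 then
          Wrec N τ γ n (fun j => z j.succ) (fun i => lam i - if g 0 = i then γ else 0)
            (Fin.tail f) (Fin.tail g)
        else 0)

/-- `W^S_n(λ) = W_n(z^S, λ)` with `z^S = (0, γ, 2γ, …, (n-1)γ)`. -/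
def WS (N n : ℕ) (τ γ : ℂ) (lam : Fin N → ℂ) :
    Matrix (Fin n → Fin N) (Fin n → Fin N) ℂ :=
  Wrec N τ γ n (fun j => ((j : ℕ) : ℂ) * γ) lam

/-- `z^∧ = ((n-1)γ, …, 2γ, γ, 0)`. -/
def zWedge (n : ℕ) (γ : ℂ) : Fin n → ℂ := fun j => ((n - 1 - (j : ℕ) : ℕ) : ℂ) * γ

/-- `W^∧_n(λ) = lim_{z → z^∧} ∏_{j=1}^{n-1} (z_j - z_{j+1} - γ) · ρ W_n(z,λ) ρ`,
where `ρ` reverses the order of the tensor factors. -/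
def Wwedge (N n : ℕ) (τ γ : ℂ) (lam : Fin N → ℂ) :
    Matrix (Fin n → Fin N) (Fin n → Fin N) ℂ :=
  limUnder (𝓝[≠] zWedge n γ) fun z : Fin n → ℂ =>
    (∏ j : Fin n, if h : (j : ℕ) + 1 < n then z j - z ⟨(j : ℕ) + 1, h⟩ - γ else 1) •
      Matrix.of fun f g : Fin n → Fin N => Wrec N τ γ n z lam (f ∘ Fin.rev) (g ∘ Fin.rev)

/-- The space `S²(ℂ^N)` of symmetric tensors in `ℂ^N ⊗ ℂ^N`. -/
def symPair (N : ℕ) : Submodule ℂ ((Fin N × Fin N) → ℂ) where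
  carrier := {v | ∀ p : Fin N × Fin N, v p = v (p.2, p.1)}
  add_mem' := by intro a b ha hb p; simp only [Pi.add_apply, ha p, hb p]
  zero_mem' := by intro p; rfl
  smul_mem' := by intro c v hv p; simp only [Pi.smul_apply, hv p]

/-- `R^{reg}(γ,λ) = lim_{z→γ} (z-γ) R(z,λ)`. -/
def Rreg (N : ℕ) (τ γ : ℂ) (lam : Fin N → ℂ) : Matrix (Fin N × Fin N) (Fin N × Fin N) ℂ :=
  limUnder (𝓝[≠] γ) fun z : ℂ => (z - γ) • Rmat N τ γ z lam

/-- The flip `P : u ⊗ v ↦ v ⊗ u` on `ℂ^N ⊗ ℂ^N`. -/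
def Pmat (N : ℕ) : Matrix (Fin N × Fin N) (Fin N × Fin N) ℂ := fun p q =>
  if q = (p.2, p.1) then 1 else 0

/-- The space `S^n(ℂ^N)` of symmetric tensors in `(ℂ^N)^{⊗n}`. -/
def symTensors (N n : ℕ) : Submodule ℂ ((Fin n → Fin N) → ℂ) where
  carrier := {v | ∀ (σ : Equiv.Perm (Fin n)) (f : Fin n → Fin N), v (f ∘ σ) = v f}
  add_mem' := by intro a b ha hb σ f; simp only [Pi.add_apply, ha σ f, hb σ f]
  zero_mem' := by intro σ f; rfl
  smul_mem' := by intro c v hv σ f; simp only [Pi.smul_apply, hv σ f]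

/-- `J_n(ℂ^N)`: the span of tensors `σ v - sign(σ) v`. -/
def Jspan (N n : ℕ) : Submodule ℂ ((Fin n → Fin N) → ℂ) :=
  Submodule.span ℂ {w | ∃ (σ : Equiv.Perm (Fin n)) (v : (Fin n → Fin N) → ℂ),
    w = (fun f => v (f ∘ σ)) - ((Equiv.Perm.sign σ : ℤ) : ℂ) • v}

/-- `ℂ^N ⊗ W ⊆ ℂ^N ⊗ (ℂ^N)^{⊗ n}` for a subspace `W ⊆ (ℂ^N)^{⊗ n}`. -/
def consSlice (N n : ℕ) (W : Submodule ℂ ((Fin n → Fin N) → ℂ)) :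
    Submodule ℂ ((Fin (n + 1) → Fin N) → ℂ) where
  carrier := {v | ∀ i : Fin N, (fun g : Fin n → Fin N => v (Fin.cons i g)) ∈ W}
  add_mem' := by intro a b ha hb i; exact W.add_mem (ha i) (hb i)
  zero_mem' := by intro i; exact W.zero_mem
  smul_mem' := by intro c v hv i; exact W.smul_mem c (hv i)

/-- The `L`-operator of `V^{⊗n}(w)`:
`L(z,λ) = R(z-w, λ-γ∑_{j=2}^n h^{(j)})^{(01)} ⋯ R(z-w-γ(n-1), λ)^{(0n)}`,
acting on `ℂ^N ⊗ (ℂ^N)^{⊗n}` with factors numbered `0,…,n`. -/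
def Lop (N n : ℕ) (τ γ z w : ℂ) (lam : Fin N → ℂ) :
    Matrix (Fin (n + 1) → Fin N) (Fin (n + 1) → Fin N) ℂ :=
  ((List.finRange n).map fun j : Fin n =>
    Rop N (n + 1) τ γ (z - w - (j : ℕ) * γ) lam
      (Finset.univ.filter fun c : Fin (n + 1) => j.succ < c) 0 j.succ).prod

/-- The `L`-operator for the opposite coproduct:
`L'(z,λ) = R(z-w-γ(n-1), λ-γ∑_{j=1}^{n-1} h^{(j)})^{(0n)} ⋯ R(z-w, λ)^{(01)}`. -/
def Lop' (N n : ℕ) (τ γ z w : ℂ) (lam : Fin N → ℂ) :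
    Matrix (Fin (n + 1) → Fin N) (Fin (n + 1) → Fin N) ℂ :=
  (((List.finRange n).reverse).map fun j : Fin n =>
    Rop N (n + 1) τ γ (z - w - (j : ℕ) * γ) lam
      (Finset.univ.filter fun c : Fin (n + 1) => 0 < c ∧ c < j.succ) 0 j.succ).prod

/-- `Id ⊗ M` on `ℂ^N ⊗ (ℂ^N)^{⊗n}`. -/
def idTensor (N n : ℕ) (M : Matrix (Fin n → Fin N) (Fin n → Fin N) ℂ) :
    Matrix (Fin (n + 1) → Fin N) (Fin (n + 1) → Fin N) ℂ :=
  Matrix.of fun f g => if f 0 = g 0 then M (Fin.tail f) (Fin.tail g) else 0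

/-- `Id ⊗ M(λ - γ h^{(0)})` on `ℂ^N ⊗ (ℂ^N)^{⊗n}`. -/
def idTensorShift (N n : ℕ) (γ : ℂ)
    (M : (Fin N → ℂ) → Matrix (Fin n → Fin N) (Fin n → Fin N) ℂ) (lam : Fin N → ℂ) :
    Matrix (Fin (n + 1) → Fin N) (Fin (n + 1) → Fin N) ℂ :=
  Matrix.of fun f g =>
    if f 0 = g 0 then M (fun i => lam i - if g 0 = i then γ else 0) (Fin.tail f) (Fin.tail g)
    else 0

/-- The zero-weight symmetric tensor `e`: the sum of all `e_{i_1} ⊗ ⋯ ⊗ e_{i_n}` over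
sequences in which each index occurs exactly `ℓ` times. -/
def evec (N n ℓ : ℕ) : (Fin n → Fin N) → ℂ := fun f =>
  if ∀ i : Fin N, (Finset.univ.filter fun j => f j = i).card = ℓ then 1 else 0

/-- The multi-index of `ē = e_1^{⊗ℓ} ⊗ ⋯ ⊗ e_N^{⊗ℓ}`. -/
def barIdx (N ℓ : ℕ) : Fin (N * ℓ) → Fin N := fun j =>
  ⟨j.val / ℓ, by
    have h : (j : ℕ) < ℓ * N := by rw [Nat.mul_comm ℓ N]; exact j.isLt
    exact Nat.div_lt_of_lt_mul h⟩

/-- `g_{N,ℓ}(λ) = ∏_{1≤j<k≤N} ∏_{s=1}^ℓ θ(λ_j-λ_k+γs)/θ(λ_j-λ_k-γ(s-1))`. -/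
def gfun (N ℓ : ℕ) (τ γ : ℂ) (lam : Fin N → ℂ) : ℂ :=
  ∏ j : Fin N, ∏ k : Fin N,
    if j < k then
      ∏ s ∈ Finset.Icc 1 ℓ,
        theta τ (lam j - lam k + γ * (s : ℂ)) / theta τ (lam j - lam k - γ * ((s : ℂ) - 1))
    else 1

/-- The permutation induced by a word in the generators `s_1, …, s_n` of `S_{n+1}`:
`π_k = s_{a_1} ∘ ⋯ ∘ s_{a_k}` (letters `a` act as the transposition of `a` and `a+1`). -/
def permOfWord {n : ℕ} : List (Fin n) → Equiv.Perm (Fin (n + 1))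
  | [] => 1
  | a :: rest => Equiv.swap a.castSucc a.succ * permOfWord rest

/-- The product of R-matrices attached to a word (with accumulated permutation `π`):
`W_w(z,λ) = F_k ⋯ F_1` where for the `t`-th letter `a`
`F_t = R(z_{π(a)} - z_{π(a+1)}, λ - γ ∑_{b<a} h^{(π(b))})^{(π(a), π(a+1))}`,
`π = π_{t-1}` the permutation induced by the earlier letters. -/
def Wword (N : ℕ) {n : ℕ} (τ γ : ℂ) (z : Fin (n + 1) → ℂ) (lam : Fin N → ℂ) :
    List (Fin n) → Equiv.Perm (Fin (n + 1)) →
      Matrix (Fin (n + 1) → Fin N) (Fin (n + 1) → Fin N) ℂ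
  | [], _ => 1
  | a :: rest, π =>
      Wword N τ γ z lam rest (π * Equiv.swap a.castSucc a.succ) *
        Rop N (n + 1) τ γ (z (π a.castSucc) - z (π a.succ)) lam
          ((Finset.univ.filter fun c : Fin (n + 1) => (c : ℕ) < (a : ℕ)).image π)
          (π a.castSucc) (π a.succ)

/-- The fused R-matrix `𝓡_{V^{⊗m}(z), V^{⊗n}(w)}(λ)` on `(ℂ^N)^{⊗(m+n)}`
(first block: factors `0,…,m-1`; second block: factors `m,…,m+n-1`). -/
def Rmn (N m n : ℕ) (τ γ z w : ℂ) (lam : Fin N → ℂ) :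
    Matrix (Fin (m + n) → Fin N) (Fin (m + n) → Fin N) ℂ :=
  ((List.finRange m).map fun a : Fin m =>
    ((List.finRange n).map fun j : Fin n =>
      Rop N (m + n) τ γ (z + (a : ℕ) * γ - w - (j : ℕ) * γ) lam
        (Finset.univ.filter fun c : Fin (m + n) =>
          (c : ℕ) < (a : ℕ) ∨ m + (j : ℕ) < (c : ℕ))
        (Fin.castAdd n a) (Fin.natAdd m j)).prod).prod

/-- `A ⊗ B ⊆ (ℂ^N)^{⊗m} ⊗ (ℂ^N)^{⊗n}`, realised as `(A ⊗ V₂) ∩ (V₁ ⊗ B)`. -/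
def blockSub (N m n : ℕ) (A : Submodule ℂ ((Fin m → Fin N) → ℂ))
    (B : Submodule ℂ ((Fin n → Fin N) → ℂ)) :
    Submodule ℂ ((Fin (m + n) → Fin N) → ℂ) where
  carrier := {v |
    (∀ g : Fin n → Fin N, (fun f : Fin m → Fin N => v (Fin.append f g)) ∈ A) ∧
    ∀ f : Fin m → Fin N, (fun g : Fin n → Fin N => v (Fin.append f g)) ∈ B}
  add_mem' := by
    intro x y hx hy
    exact ⟨fun g => A.add_mem (hx.1 g) (hy.1 g), fun f => B.add_mem (hx.2 f) (hy.2 f)⟩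
  zero_mem' := ⟨fun _ => A.zero_mem, fun _ => B.zero_mem⟩
  smul_mem' := by
    intro c x hx
    exact ⟨fun g => A.smul_mem c (hx.1 g), fun f => B.smul_mem c (hx.2 f)⟩

/-- Matrix element `L_{jk}(z,λ)` of the `L`-operator (evaluation point `w = 0`),
as an operator on `(ℂ^N)^{⊗n}`: `L(z,λ)(e_k ⊗ v) = ∑_j e_j ⊗ L_{jk}(z,λ) v`. -/
def LmatEl (N n : ℕ) (τ γ z : ℂ) (lam : Fin N → ℂ) (j k : Fin N)
    (v : (Fin n → Fin N) → ℂ) : (Fin n → Fin N) → ℂ := fun g =>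
  (Lop N n τ γ z 0 lam).mulVec
    (fun f => (if f 0 = k then (1 : ℂ) else 0) * v (Fin.tail f)) (Fin.cons j g)

/-- `L_{j_{σ(1)} j_1}(z, λ-γ(ω_{j_2}+⋯+ω_{j_m})) ∘ ⋯ ∘ L_{j_{σ(m)} j_m}(z-(m-1)γ, λ)`. -/
def chainT (N n m : ℕ) (τ γ z : ℂ) (lam : Fin N → ℂ) (jt : Fin m → Fin N)
    (σ : Equiv.Perm (Fin m)) (v : (Fin n → Fin N) → ℂ) : (Fin n → Fin N) → ℂ :=
  (List.finRange m).foldr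
    (fun (t : Fin m) acc =>
      LmatEl N n τ γ (z - (t.val : ℂ) * γ)
        (fun i => lam i -
          γ * ((Finset.univ.filter fun s : Fin m => t < s ∧ jt s = i).card : ℂ))
        (jt (σ t)) (jt t) acc)
    v

/-- The transfer matrix `T_m(z)`, acting on scalar functions of `λ` via the identification
of the zero weight space of `S^{Nℓ}(ℂ^N)` with `ℂ` by the basis vector `e`:
`T_m(z) f(λ) = ∑_{j_1<⋯<j_m} ∑_{σ} (-1)^σ [L_{j_{σ(1)} j_1}(z,λ-γ(ω_{j_2}+⋯+ω_{j_m})) ⋯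
L_{j_{σ(m)} j_m}(z-(m-1)γ, λ)] e · f(λ-γ(ω_{j_1}+⋯+ω_{j_m}))`. -/
def Tm (N ℓ m : ℕ) (τ γ z : ℂ) (lam : Fin N → ℂ) (f : (Fin N → ℂ) → ℂ) : ℂ :=
  ∑ jt ∈ Finset.univ.filter fun jt : Fin m → Fin N => ∀ s t : Fin m, s < t → jt s < jt t,
    ∑ σ : Equiv.Perm (Fin m),
      ((Equiv.Perm.sign σ : ℤ) : ℂ) *
        chainT N (N * ℓ) m τ γ z lam jt σ (evec N (N * ℓ) ℓ) (barIdx N ℓ) *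
        f fun i => lam i - if ∃ t, jt t = i then γ else 0

/-- The `m`-th Ruijsenaars operator with coupling constant `ℓ`:
`M_m f(λ) = ∑_{|J|=m} ∏_{j∈J,k∉J} θ(λ_j-λ_k+ℓγ)/θ(λ_j-λ_k) · f(λ-γ∑_{j∈J}ω_j)`. -/
def Mm (N ℓ m : ℕ) (τ γ : ℂ) (f : (Fin N → ℂ) → ℂ) (lam : Fin N → ℂ) : ℂ :=
  ∑ J ∈ Finset.powersetCard m (Finset.univ : Finset (Fin N)),
    (∏ j ∈ J, ∏ k ∈ Jᶜ, theta τ (lam j - lam k + (ℓ : ℂ) * γ) / theta τ (lam j - lam k)) *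
      f fun i => lam i - if i ∈ J then γ else 0

/-- The transfer matrix with auxiliary space indexed by `ι` (weights `wt`) and quantum
space indexed by `ι₃`: `T f(λ) = ∑_μ tr_{W[μ]}(𝓡(λ)) f(λ-γμ)`. -/
def transferOp {N : ℕ} {ι ι₃ : Type} [Fintype ι] [Fintype ι₃] (γ : ℂ)
    (wt : ι → Fin N → ℂ) (R : (Fin N → ℂ) → Matrix (ι × ι₃) (ι × ι₃) ℂ)
    (f : (Fin N → ℂ) → ι₃ → ℂ) : (Fin N → ℂ) → ι₃ → ℂ := fun lam b =>
  ∑ a : ι, ∑ b' : ι₃, R lam (a, b) (a, b') * f (fun r => lam r - γ * wt a r) b'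


section ThetaIdentities

variable {τ : ℂ}

/-- The general term of the series of `ϑ₃(2x | 2τ)`. -/
def evenTerm (τ x : ℂ) (s : ℤ) : ℂ :=
  Complex.exp (2 * (Real.pi : ℂ) * Complex.I * (s : ℂ) ^ 2 * τ +
    4 * (Real.pi : ℂ) * Complex.I * (s : ℂ) * x)

/-- The general term of the series of `ϑ₂(2x | 2τ)`. -/
def oddTerm (τ x : ℂ) (s : ℤ) : ℂ :=
  Complex.exp (2 * (Real.pi : ℂ) * Complex.I * ((s : ℂ) + 1 / 2) ^ 2 * τ +
    4 * (Real.pi : ℂ) * Complex.I * ((s : ℂ) + 1 / 2) * x)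

lemma summable_exp_quadratic (hτ : 0 < τ.im) (c x : ℂ) {f : ℤ → ℂ}
    (hf : ∀ j : ℤ, f j = Complex.exp (c + (2 * (Real.pi : ℂ) * Complex.I * j * x +
      (Real.pi : ℂ) * Complex.I * (j : ℂ) ^ 2 * τ))) : Summable f := by
  have h := ((summable_jacobiTheta₂_term_iff x τ).2 hτ).mul_left (Complex.exp c)
  refine h.congr fun j => ?_
  rw [hf, Complex.exp_add, jacobiTheta₂_term]

lemma summable_thetaTerm (hτ : 0 < τ.im) (z : ℂ) :
    Summable fun j : ℤ => Complex.exp ((Real.pi : ℂ) * Complex.I * ((j : ℂ) + 1 / 2) ^ 2 * τ +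
      2 * (Real.pi : ℂ) * Complex.I * ((j : ℂ) + 1 / 2) * (z + 1 / 2)) :=
  summable_exp_quadratic hτ ((Real.pi : ℂ) * Complex.I * τ / 4 +
    (Real.pi : ℂ) * Complex.I * (z + 1 / 2)) (τ / 2 + z + 1 / 2) fun j => by
      congr 1; ring

lemma two_mul_im_pos (hτ : 0 < τ.im) : 0 < (2 * τ).im := by simpa using hτ

lemma summable_evenTerm (hτ : 0 < τ.im) (x : ℂ) : Summable (evenTerm τ x) :=
  summable_exp_quadratic (two_mul_im_pos hτ) 0 (2 * x) fun j => by
    rw [evenTerm]; congr 1; ring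

lemma summable_oddTerm (hτ : 0 < τ.im) (x : ℂ) : Summable (oddTerm τ x) :=
  summable_exp_quadratic (two_mul_im_pos hτ) ((Real.pi : ℂ) * Complex.I * τ / 2 +
    2 * (Real.pi : ℂ) * Complex.I * x) (τ + 2 * x) fun j => by
      rw [oddTerm]; congr 1; ring

lemma hasSum_mul_of_summable {f g : ℤ → ℂ} (hf : Summable f) (hg : Summable g) :
    HasSum (fun p : ℤ × ℤ => f p.1 * g p.2) ((∑' s, f s) * ∑' s, g s) :=
  hf.hasSum.mul hg.hasSum (summable_mul_of_summable_norm hf.norm hg.norm)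

lemma neg_exp_eq (w : ℂ) : -Complex.exp w = Complex.exp (w + Real.pi * Complex.I) := by
  rw [Complex.exp_add, Complex.exp_pi_mul_I, mul_neg_one]

/-- The theta function is odd. -/
lemma theta_neg (τ z : ℂ) : theta τ (-z) = -theta τ z := by
  unfold theta
  rw [neg_neg, ← (Equiv.subLeft (-1 : ℤ)).tsum_eq, ← tsum_neg]
  refine tsum_congr fun j => ?_
  rw [Equiv.subLeft_apply, neg_exp_eq, Complex.exp_eq_exp_iff_exists_int]
  exact ⟨-j, by push_cast; ring⟩

/-- The product `θ(x+y)θ(x-y)` as a `2 × 2` determinant. -/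
lemma theta_add_mul_theta_sub (hτ : 0 < τ.im) (x y : ℂ) :
    theta τ (x + y) * theta τ (x - y) =
      (∑' s, evenTerm τ x s) * (∑' s, oddTerm τ y s) -
        (∑' s, oddTerm τ x s) * (∑' s, evenTerm τ y s) := by
  have hprod := hasSum_mul_of_summable (summable_thetaTerm hτ (x + y))
    (summable_thetaTerm hτ (x - y))
  set F : ℤ × ℤ → ℂ := fun p => _ * _ with hF
  have h₀ := hasSum_mul_of_summable (summable_evenTerm hτ x) (summable_oddTerm hτ y)
  have h₁ := (hasSum_mul_of_summable (summable_oddTerm hτ x) (summable_evenTerm hτ y)).neg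
  let φ₀ : ℤ × ℤ → ℤ × ℤ := fun p => (p.1 + p.2, p.1 - p.2 - 1)
  let φ₁ : ℤ × ℤ → ℤ × ℤ := fun p => (p.1 + p.2, p.1 - p.2)
  have i₀ : Function.Injective φ₀ := by
    rintro ⟨a, b⟩ ⟨c, d⟩ h
    simp only [φ₀, Prod.mk.injEq] at h ⊢
    omega
  have i₁ : Function.Injective φ₁ := by
    rintro ⟨a, b⟩ ⟨c, d⟩ h
    simp only [φ₁, Prod.mk.injEq] at h ⊢
    omega
  have hcompl : IsCompl (Set.range φ₀) (Set.range φ₁) := by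
    refine ⟨Set.disjoint_left.2 ?_, codisjoint_iff_le_sup.2 ?_⟩
    · rintro _ ⟨⟨a, b⟩, rfl⟩ ⟨⟨c, d⟩, h⟩
      simp only [φ₀, φ₁, Prod.mk.injEq] at h
      omega
    · rintro ⟨a, b⟩ -
      rcases Int.even_or_odd' (a + b) with ⟨k, hk | hk⟩
      · exact Or.inr ⟨(k, a - k), by simp only [φ₁, Prod.mk.injEq]; omega⟩
      · exact Or.inl ⟨(k + 1, a - k - 1), by simp only [φ₀, Prod.mk.injEq]; omega⟩
  have e₀ : F ∘ φ₀ = fun p : ℤ × ℤ => evenTerm τ x p.1 * oddTerm τ y p.2 := by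
    funext ⟨s, t⟩
    simp only [hF, φ₀, Function.comp_apply, evenTerm, oddTerm, ← Complex.exp_add]
    rw [Complex.exp_eq_exp_iff_exists_int]
    exact ⟨s, by push_cast; ring⟩
  have e₁ : F ∘ φ₁ = fun p : ℤ × ℤ => -(oddTerm τ x p.1 * evenTerm τ y p.2) := by
    funext ⟨s, t⟩
    simp only [hF, φ₁, Function.comp_apply, evenTerm, oddTerm, ← Complex.exp_add, neg_exp_eq]
    rw [Complex.exp_eq_exp_iff_exists_int]
    exact ⟨s, by push_cast; ring⟩
  rw [← e₀] at h₀
  rw [← e₁] at h₁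
  have hsum := HasSum.add_isCompl (f := F) hcompl (i₀.hasSum_range_iff.2 h₀)
    (i₁.hasSum_range_iff.2 h₁)
  simpa only [theta, neg_mul_neg, ← sub_eq_add_neg] using hprod.unique hsum

/-- The Weierstrass three-term identity. -/
lemma theta_three_term (hτ : 0 < τ.im) (x y z w : ℂ) :
    theta τ (x + y) * theta τ (x - y) * (theta τ (z + w) * theta τ (z - w)) -
      theta τ (x + z) * theta τ (x - z) * (theta τ (y + w) * theta τ (y - w)) +
      theta τ (x + w) * theta τ (x - w) * (theta τ (y + z) * theta τ (y - z)) = 0 := by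
  simp only [theta_add_mul_theta_sub hτ]
  ring

end ThetaIdentities

section FusionIdentities

variable {τ γ u x y : ℂ}

lemma alphaF_mul_alphaF_comm (τ γ u x y : ℂ) :
    alphaF τ γ u x * alphaF τ γ (u - γ) y = alphaF τ γ u y * alphaF τ γ (u - γ) x := by
  unfold alphaF
  ring

lemma alphaF_mul_betaF_add_betaF_mul_betaF (hτ : 0 < τ.im) (hu : theta τ (u - γ) ≠ 0)
    (hu' : theta τ (u - γ - γ) ≠ 0) (hx : theta τ x ≠ 0) (hy : theta τ y ≠ 0)
    (hxy : theta τ (y - x) ≠ 0) :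
    alphaF τ γ u x * betaF τ γ (u - γ) y + betaF τ γ u x * betaF τ γ (u - γ) (y - x) =
      betaF τ γ u y * alphaF τ γ (u - γ) (x - y) := by
  have key := theta_three_term hτ (u + (y - γ) / 2) ((y + γ) / 2) (x + (γ - y) / 2) ((γ - y) / 2)
  rw [show u + (y - γ) / 2 + (y + γ) / 2 = u + y by ring,
    show u + (y - γ) / 2 - (y + γ) / 2 = u - γ by ring,
    show x + (γ - y) / 2 + (γ - y) / 2 = x - y + γ by ring,
    show x + (γ - y) / 2 - (γ - y) / 2 = x by ring,
    show u + (y - γ) / 2 + (x + (γ - y) / 2) = u + x by ring,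
    show u + (y - γ) / 2 - (x + (γ - y) / 2) = u - γ + (y - x) by ring,
    show (y + γ) / 2 + (γ - y) / 2 = γ by ring,
    show (y + γ) / 2 - (γ - y) / 2 = y by ring,
    show u + (y - γ) / 2 + (γ - y) / 2 = u by ring,
    show u + (y - γ) / 2 - (γ - y) / 2 = u - γ + y by ring,
    show (y + γ) / 2 + (x + (γ - y) / 2) = x + γ by ring,
    show (y + γ) / 2 - (x + (γ - y) / 2) = y - x by ring] at key
  unfold alphaF betaF
  rw [show theta τ (x - y) = -theta τ (y - x) by rw [← theta_neg, neg_sub]]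
  field_simp
  linear_combination (-theta τ γ) * key

lemma betaF_eq_betaF_mul_alphaF (hu : theta τ (u - γ) ≠ 0) (hy : theta τ (y - γ) ≠ 0) :
    betaF τ γ (u - γ) y = betaF τ γ u (y - γ) * alphaF τ γ (u - γ) (-y) := by
  unfold alphaF betaF
  rw [theta_neg, show -y + γ = -(y - γ) by ring, theta_neg,
    show u + (y - γ) = u - γ + y by ring]
  field_simp

lemma alphaF_eq_alphaF_add_betaF_mul_betaF (hτ : 0 < τ.im) (hu : theta τ (u - γ) ≠ 0)
    (hu' : theta τ (u - γ - γ) ≠ 0) (hy : theta τ y ≠ 0) (hy' : theta τ (y - γ) ≠ 0) :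
    alphaF τ γ (u - γ) y =
      alphaF τ γ u (y - γ) + betaF τ γ u (y - γ) * betaF τ γ (u - γ) (-y) := by
  have key := theta_three_term hτ (u - γ) y γ 0
  simp only [add_zero, sub_zero, sub_add_cancel] at key
  unfold alphaF betaF
  rw [theta_neg, sub_add_cancel, show u + (y - γ) = u - γ + y by ring,
    ← sub_eq_add_neg (u - γ) y]
  field_simp
  linear_combination key

end FusionIdentities

section PairFusion

variable {ι : Type*} [DecidableEq ι]

/-- A component of `R(u, M)` applied to a vector, in terms of the component `p` at `(i, j)` and
the component `q` at `(j, i)`. -/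
def rAct (τ γ u : ℂ) (M : ι → ℂ) (i j : ι) (p q : ℂ) : ℂ :=
  if i = j then p else alphaF τ γ u (M i - M j) * p + betaF τ γ u (M i - M j) * q

/-- A component of `R(u, M - γ h^{(2)})^{(01)} R(u - γ, M)^{(02)} V`. -/
def pairAct (τ γ u : ℂ) (M : ι → ℂ) (V : ι → ι → ι → ℂ) (a b c : ι) : ℂ :=
  rAct τ γ u (fun i => M i - if c = i then γ else 0) a b
    (rAct τ γ (u - γ) M a c (V a b c) (V c b a)) (rAct τ γ (u - γ) M b c (V b a c) (V c a b))

variable {τ γ u : ℂ} {M : ι → ℂ} {V : ι → ι → ι → ℂ}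

lemma pairAct_self_left (hτ : 0 < τ.im) (hu : theta τ (u - γ) ≠ 0)
    (hu' : theta τ (u - γ - γ) ≠ 0) (hM : ∀ i j, i ≠ j → theta τ (M i - M j) ≠ 0)
    (hM' : ∀ i j, i ≠ j → theta τ (M i - M j - γ) ≠ 0)
    (hV : ∀ a b c, V a b c = V a c b) {a c : ι} (hac : a ≠ c) :
    pairAct τ γ u M V a a c = pairAct τ γ u M V a c a := by
  simp only [pairAct, rAct, if_true, if_neg hac, if_neg hac.symm]
  rw [show M a - γ - (M c - 0) = M a - M c - γ by ring,
    show M c - M a = -(M a - M c) by ring, hV a c a,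
    alphaF_eq_alphaF_add_betaF_mul_betaF hτ hu hu' (hM a c hac) (hM' a c hac),
    betaF_eq_betaF_mul_alphaF hu (hM' a c hac)]
  ring

/-- The fused pair of R-matrices preserves symmetry in the last two tensor factors. -/
lemma pairAct_comm (hτ : 0 < τ.im) (hu : theta τ (u - γ) ≠ 0)
    (hu' : theta τ (u - γ - γ) ≠ 0) (hM : ∀ i j, i ≠ j → theta τ (M i - M j) ≠ 0)
    (hM' : ∀ i j, i ≠ j → theta τ (M i - M j - γ) ≠ 0)
    (hV : ∀ a b c, V a b c = V a c b) (a b c : ι) :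
    pairAct τ γ u M V a b c = pairAct τ γ u M V a c b := by
  by_cases hbc : b = c
  · rw [hbc]
  by_cases hab : a = b
  · subst hab
    exact pairAct_self_left hτ hu hu' hM hM' hV hbc
  by_cases hac : a = c
  · subst hac
    exact (pairAct_self_left hτ hu hu' hM hM' hV hab).symm
  have h₁ := alphaF_mul_betaF_add_betaF_mul_betaF (x := M a - M b) (y := M a - M c) hτ hu hu'
    (hM a b hab) (hM a c hac) (by simpa using hM b c hbc)
  have h₂ := alphaF_mul_betaF_add_betaF_mul_betaF (x := M a - M c) (y := M a - M b) hτ hu hu'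
    (hM a c hac) (hM a b hab) (by simpa using hM c b (Ne.symm hbc))
  have h₃ := alphaF_mul_alphaF_comm τ γ u (M a - M b) (M a - M c)
  simp only [sub_sub_sub_cancel_left] at h₁ h₂
  simp only [pairAct, rAct, if_neg hab, if_neg hac, if_neg hbc, if_neg (Ne.symm hab),
    if_neg (Ne.symm hac), if_neg (Ne.symm hbc), sub_zero]
  rw [hV a c b, hV c b a, hV b c a]
  linear_combination V a b c * h₃ + V c a b * h₁ - V b a c * h₂

end PairFusion

section SwapInvariance

variable {N n : ℕ}

/-- The tensors invariant under exchanging the factors `a` and `b`. -/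
def swapInvariants (N : ℕ) {n : ℕ} (a b : Fin n) : Submodule ℂ ((Fin n → Fin N) → ℂ) where
  carrier := {v | ∀ f : Fin n → Fin N, v (f ∘ Equiv.swap a b) = v f}
  add_mem' := by intro v w hv hw f; simp only [Pi.add_apply, hv f, hw f]
  zero_mem' := by intro f; rfl
  smul_mem' := by intro c v hv f; simp only [Pi.smul_apply, hv f]

lemma mem_swapInvariants {a b : Fin n} {v : (Fin n → Fin N) → ℂ} :
    v ∈ swapInvariants N a b ↔ ∀ f : Fin n → Fin N, v (f ∘ Equiv.swap a b) = v f :=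
  Iff.rfl

lemma shiftL_congr {γ : ℂ} {lam : Fin N → ℂ} {S : Finset (Fin n)} {f g : Fin n → Fin N}
    (h : ∀ c ∈ S, f c = g c) : shiftL γ lam S f = shiftL γ lam S g := by
  funext i
  unfold shiftL
  rw [Finset.filter_congr fun c hc => by rw [h c hc]]

lemma shiftL_comp_swap (γ : ℂ) (lam : Fin N → ℂ) {S : Finset (Fin n)} {a b : Fin n}
    (h : a ∈ S ↔ b ∈ S) (f : Fin n → Fin N) :
    shiftL γ lam S (f ∘ Equiv.swap a b) = shiftL γ lam S f := by
  funext i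
  unfold shiftL
  congr 3
  have hmem : ∀ c ∈ S, Equiv.swap a b c ∈ S := by
    intro c hc
    rcases eq_or_ne c a with rfl | hca
    · rw [Equiv.swap_apply_left]; exact h.1 hc
    rcases eq_or_ne c b with rfl | hcb
    · rw [Equiv.swap_apply_right]; exact h.2 hc
    · rwa [Equiv.swap_apply_of_ne_of_ne hca hcb]
  refine Finset.card_bij' (fun c _ => Equiv.swap a b c) (fun c _ => Equiv.swap a b c)
    (fun c hc => ?_) (fun c hc => ?_) (fun c _ => Equiv.swap_apply_self a b c)
    fun c _ => Equiv.swap_apply_self a b c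
  all_goals
    rw [Finset.mem_filter] at hc ⊢
    exact ⟨hmem c hc.1, by simpa using hc.2⟩

lemma shiftL_insert (γ : ℂ) (lam : Fin N → ℂ) {S : Finset (Fin n)} {q : Fin n} (hq : q ∉ S)
    (f : Fin n → Fin N) :
    shiftL γ lam (insert q S) f = fun i => shiftL γ lam S f i - if f q = i then γ else 0 := by
  funext i
  unfold shiftL
  rw [Finset.filter_insert]
  split_ifs with h
  · rw [Finset.card_insert_of_notMem fun hq' => hq (Finset.mem_filter.1 hq').1]
    push_cast
    ring
  · ring

lemma eq_comp_swap_iff {a b : Fin n} {f g : Fin n → Fin N} :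
    g = f ∘ Equiv.swap a b ↔ (∀ c, c ≠ a → c ≠ b → f c = g c) ∧ g a = f b ∧ g b = f a := by
  constructor
  · rintro rfl
    refine ⟨fun c ha hb => ?_, ?_, ?_⟩
    · simp [Equiv.swap_apply_of_ne_of_ne ha hb]
    · simp
    · simp
  · rintro ⟨h, ha, hb⟩
    funext c
    rcases eq_or_ne c a with rfl | hca
    · simpa using ha
    rcases eq_or_ne c b with rfl | hcb
    · simpa using hb
    · simp [Equiv.swap_apply_of_ne_of_ne hca hcb, h c hca hcb]

lemma eq_iff_agree {a b : Fin n} {f g : Fin n → Fin N} :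
    g = f ↔ (∀ c, c ≠ a → c ≠ b → f c = g c) ∧ g a = f a ∧ g b = f b := by
  constructor
  · rintro rfl
    exact ⟨fun _ _ _ => rfl, rfl, rfl⟩
  · rintro ⟨h, ha, hb⟩
    funext c
    by_cases hca : c = a
    · rw [hca, ha]
    by_cases hcb : c = b
    · rw [hcb, hb]
    · exact (h c hca hcb).symm

lemma Rop_mulVec_apply (τ γ z : ℂ) (lam : Fin N → ℂ) {S : Finset (Fin n)} {a b : Fin n}
    (ha : a ∉ S) (hb : b ∉ S) (v : (Fin n → Fin N) → ℂ) (f : Fin n → Fin N) :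
    (Rop N n τ γ z lam S a b).mulVec v f =
      rAct τ γ z (shiftL γ lam S f) (f a) (f b) (v f) (v (f ∘ Equiv.swap a b)) := by
  have hentry : ∀ g, Rop N n τ γ z lam S a b f g = rAct τ γ z (shiftL γ lam S f) (f a) (f b)
      (if g = f then 1 else 0) (if g = f ∘ Equiv.swap a b then 1 else 0) := by
    intro g
    unfold Rop
    by_cases h : ∀ c, c ≠ a → c ≠ b → f c = g c
    · rw [if_pos h]
      have hM : shiftL γ lam S g = shiftL γ lam S f := shiftL_congr fun c hc =>
        (h c (fun e => ha (e ▸ hc)) (fun e => hb (e ▸ hc))).symm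
      have e₁ : (g a, g b) = (f a, f b) ↔ g = f := by
        rw [eq_iff_agree (a := a) (b := b), Prod.mk.injEq]
        exact ⟨fun e => ⟨h, e⟩, fun e => e.2⟩
      have e₂ : (g a, g b) = (f b, f a) ↔ g = f ∘ Equiv.swap a b := by
        rw [eq_comp_swap_iff, Prod.mk.injEq]
        exact ⟨fun e => ⟨h, e⟩, fun e => e.2⟩
      simp only [Rmat, rAct, hM, e₁, e₂, mul_ite, mul_one, mul_zero]
    · rw [if_neg h]
      have h₁ : g ≠ f := fun e => h ((eq_iff_agree (a := a) (b := b)).1 e).1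
      have h₂ : g ≠ f ∘ Equiv.swap a b := fun e => h (eq_comp_swap_iff.1 e).1
      simp [rAct, h₁, h₂]
  simp only [Matrix.mulVec, dotProduct, hentry]
  unfold rAct
  split_ifs
  · simp
  · simp [add_mul, Finset.sum_add_distrib]

lemma Rop_mulVec_mem_swapInvariants (τ γ z : ℂ) (lam : Fin N → ℂ) {S : Finset (Fin n)}
    {o r p q : Fin n} (ho : o ∉ S) (hr : r ∉ S) (hop : o ≠ p) (hoq : o ≠ q) (hrp : r ≠ p)
    (hrq : r ≠ q) (hS : p ∈ S ↔ q ∈ S) {v : (Fin n → Fin N) → ℂ}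
    (hv : v ∈ swapInvariants N p q) :
    (Rop N n τ γ z lam S o r).mulVec v ∈ swapInvariants N p q := by
  intro f
  have hcomm : (f ∘ Equiv.swap p q) ∘ Equiv.swap o r = (f ∘ Equiv.swap o r) ∘ Equiv.swap p q := by
    funext c
    simp only [Function.comp_apply]
    congr 1
    simp only [Equiv.swap_apply_def]
    split_ifs <;> simp_all
  rw [Rop_mulVec_apply _ _ _ _ ho hr, Rop_mulVec_apply _ _ _ _ ho hr, shiftL_comp_swap γ lam hS,
    hcomm, hv, hv, Function.comp_apply, Function.comp_apply,
    Equiv.swap_apply_of_ne_of_ne hop hoq, Equiv.swap_apply_of_ne_of_ne hrp hrq]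

lemma Rop_pair_mulVec_mem_swapInvariants {τ γ u : ℂ} (hτ : 0 < τ.im) {lam : Fin N → ℂ}
    {S : Finset (Fin n)} {o p q : Fin n} (ho : o ∉ S) (hp : p ∉ S) (hq : q ∉ S) (hop : o ≠ p)
    (hoq : o ≠ q) (hpq : p ≠ q) (hu : theta τ (u - γ) ≠ 0) (hu' : theta τ (u - γ - γ) ≠ 0)
    (hM : ∀ (f : Fin n → Fin N) i j, i ≠ j →
      theta τ (shiftL γ lam S f i - shiftL γ lam S f j) ≠ 0)
    (hM' : ∀ (f : Fin n → Fin N) i j, i ≠ j →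
      theta τ (shiftL γ lam S f i - shiftL γ lam S f j - γ) ≠ 0)
    {v : (Fin n → Fin N) → ℂ} (hv : v ∈ swapInvariants N p q) :
    (Rop N n τ γ u lam (insert q S) o p).mulVec ((Rop N n τ γ (u - γ) lam S o q).mulVec v) ∈
      swapInvariants N p q := by
  intro f
  let G : Fin N → Fin N → Fin N → Fin n → Fin N := fun a b c i =>
    if i = o then a else if i = p then b else if i = q then c else f i
  have Go : ∀ a b c, G a b c o = a := fun a b c => by simp [G]
  have Gp : ∀ a b c, G a b c p = b := fun a b c => by simp [G, hop.symm]
  have Gq : ∀ a b c, G a b c q = c := fun a b c => by simp [G, hoq.symm, hpq.symm]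
  have Gop : ∀ a b c, G a b c ∘ Equiv.swap o p = G b a c := by
    intro a b c
    refine (eq_comp_swap_iff.2 ⟨fun i h h' => ?_, ?_, ?_⟩).symm
    · simp [G, h, h']
    · rw [Go, Gp]
    · rw [Go, Gp]
  have Goq : ∀ a b c, G a b c ∘ Equiv.swap o q = G c b a := by
    intro a b c
    refine (eq_comp_swap_iff.2 ⟨fun i h h' => ?_, ?_, ?_⟩).symm
    · simp [G, h, h']
    · rw [Go, Gq]
    · rw [Go, Gq]
  have Gpq : ∀ a b c, G a b c ∘ Equiv.swap p q = G a c b := by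
    intro a b c
    refine (eq_comp_swap_iff.2 ⟨fun i h h' => ?_, ?_, ?_⟩).symm
    · simp [G, h, h']
    · rw [Gp, Gq]
    · rw [Gp, Gq]
  have hGf : G (f o) (f p) (f q) = f := by
    funext i
    simp only [G]
    split_ifs with h₁ h₂ h₃
    · rw [h₁]
    · rw [h₂]
    · rw [h₃]
    · rfl
  have hS : ∀ a b c, shiftL γ lam S (G a b c) = shiftL γ lam S f := fun a b c =>
    shiftL_congr fun i hi => by
      have h₁ : i ≠ o := fun e => ho (e ▸ hi)
      have h₂ : i ≠ p := fun e => hp (e ▸ hi)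
      have h₃ : i ≠ q := fun e => hq (e ▸ hi)
      simp [G, h₁, h₂, h₃]
  have hact : ∀ a b c, (Rop N n τ γ u lam (insert q S) o p).mulVec
      ((Rop N n τ γ (u - γ) lam S o q).mulVec v) (G a b c) =
      pairAct τ γ u (shiftL γ lam S f) (fun a b c => v (G a b c)) a b c := by
    intro a b c
    rw [Rop_mulVec_apply _ _ _ _ (by simp [hoq, ho]) (by simp [hpq, hp]),
      Rop_mulVec_apply _ _ _ _ ho hq, Rop_mulVec_apply _ _ _ _ ho hq, shiftL_insert γ lam hq]
    simp only [Gop, Goq, Go, Gp, Gq, hS, pairAct]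
  rw [← hGf, Gpq, hact, hact]
  exact (pairAct_comm hτ hu hu' (hM f) (hM' f) (fun a b c => by rw [← hv (G a b c), Gpq])
    _ _ _).symm

lemma list_prod_mulVec_mem {ι κ : Type*} [Fintype κ] [DecidableEq κ] {W : Submodule ℂ (κ → ℂ)}
    (F : ι → Matrix κ κ ℂ) (l : List ι) (hF : ∀ j ∈ l, ∀ v ∈ W, (F j).mulVec v ∈ W)
    {v : κ → ℂ} (hv : v ∈ W) : ((l.map F).prod).mulVec v ∈ W := by
  induction l with
  | nil => simpa using hv
  | cons j l ih =>
    rw [List.map_cons, List.prod_cons, ← Matrix.mulVec_mulVec]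
    exact hF j (by simp) _ (ih fun i hi => hF i (by simp [hi]))

lemma finRange_split {m : ℕ} (k : Fin m) : List.finRange (m + 1) =
    (List.finRange (m + 1)).take k ++
      k.castSucc :: k.succ :: (List.finRange (m + 1)).drop (k + 2) := by
  conv_lhs => rw [← List.take_append_drop k (List.finRange (m + 1))]
  rw [List.drop_eq_getElem_cons (by simp), List.drop_eq_getElem_cons (by simp)]
  simp only [List.getElem_finRange]
  rfl

lemma Lop_mulVec_mem_swapInvariants {m : ℕ} {τ : ℂ} (hτ : 0 < τ.im) (z w γ : ℂ)
    (lam : Fin N → ℂ)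
    (hz : ∀ k : ℕ, 1 ≤ k → k ≤ m + 1 → theta τ (z - w - (k : ℂ) * γ) ≠ 0)
    (hlam : ∀ i j : Fin N, i ≠ j → ∀ c : ℤ, c.natAbs < m + 1 →
      theta τ (lam i - lam j + (c : ℂ) * γ) ≠ 0) (k : Fin m)
    {v : (Fin (m + 2) → Fin N) → ℂ} (hv : v ∈ swapInvariants N k.castSucc.succ k.succ.succ) :
    (Lop N (m + 1) τ γ z w lam).mulVec v ∈ swapInvariants N k.castSucc.succ k.succ.succ := by
  have hfar : ∀ j : Fin (m + 1), j ≠ k.castSucc → j ≠ k.succ →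
      ∀ v ∈ swapInvariants N k.castSucc.succ k.succ.succ,
      (Rop N (m + 1 + 1) τ γ (z - w - (j : ℕ) * γ) lam
        (Finset.univ.filter fun c : Fin (m + 1 + 1) => j.succ < c) 0 j.succ).mulVec v ∈
        swapInvariants N k.castSucc.succ k.succ.succ := by
    intro j h₁ h₂ v hv
    refine Rop_mulVec_mem_swapInvariants _ _ _ _ (by simp) (by simp) (Fin.succ_ne_zero _).symm
      (Fin.succ_ne_zero _).symm (by simpa using h₁) (by simpa using h₂) ?_ hv
    simp only [Finset.mem_filter, Finset.mem_univ, true_and, Fin.lt_def, Fin.val_succ,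
      Fin.val_castSucc, ne_eq, Fin.ext_iff] at h₁ h₂ ⊢
    omega
  unfold Lop
  rw [finRange_split k, List.map_append, List.prod_append, ← Matrix.mulVec_mulVec, List.map_cons,
    List.map_cons, List.prod_cons, List.prod_cons, ← Matrix.mulVec_mulVec, ← Matrix.mulVec_mulVec]
  refine list_prod_mulVec_mem _ _ (fun j hj => ?_) ?_
  · obtain ⟨i, hi, rfl⟩ := List.mem_take_iff_getElem.1 hj
    simp only [List.length_finRange] at hi
    apply hfar <;> · simp [Fin.ext_iff]; omega
  have hset : (Finset.univ.filter fun c : Fin (m + 1 + 1) => k.castSucc.succ < c) =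
      insert k.succ.succ (Finset.univ.filter fun c : Fin (m + 1 + 1) => k.succ.succ < c) := by
    ext c
    simp only [Finset.mem_filter, Finset.mem_univ, true_and, Finset.mem_insert, Fin.lt_def,
      Fin.val_succ, Fin.val_castSucc, Fin.ext_iff]
    omega
  have hcard : ∀ (f : Fin (m + 2) → Fin N) i, ((Finset.univ.filter
      fun c : Fin (m + 1 + 1) => k.succ.succ < c).filter fun c => f c = i).card + 1 ≤ m := by
    intro f i
    refine (Nat.add_le_add_right (Finset.card_filter_le _ _) 1).trans ?_
    have h' : (Finset.univ.filter fun c : Fin (m + 1 + 1) => k.succ.succ < c) =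
      Finset.Ioi k.succ.succ := by ext; simp
    have h'' := Fin.card_Ioi k.succ.succ
    rw [Fin.val_succ, Fin.val_succ] at h''
    rw [h', h'']
    omega
  rw [hset, show z - w - ((k.succ : Fin (m + 1)) : ℕ) * γ =
    z - w - ((k.castSucc : Fin (m + 1)) : ℕ) * γ - γ by push_cast [Fin.val_succ]; simp; ring]
  refine Rop_pair_mulVec_mem_swapInvariants hτ (by simp) (by simp [Fin.lt_def]) (by simp)
    (Fin.succ_ne_zero _).symm (Fin.succ_ne_zero _).symm (by simp [Fin.ext_iff]) ?_ ?_ ?_ ?_ ?_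
  · convert hz (k + 1) (by omega) (by omega) using 2
    push_cast [Fin.val_castSucc]; ring
  · convert hz (k + 2) (by omega) (by omega) using 2
    push_cast [Fin.val_castSucc]; ring
  · intro f i j hij
    have hi := hcard f i
    have hj := hcard f j
    unfold shiftL
    set ci := Finset.card _
    set cj := Finset.card _
    convert hlam i j hij ((cj : ℤ) - ci) (by omega) using 2
    push_cast; ring
  · intro f i j hij
    have hi := hcard f i
    have hj := hcard f j
    unfold shiftL
    set ci := Finset.card _
    set cj := Finset.card _
    convert hlam i j hij ((cj : ℤ) - ci - 1) (by omega) using 2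
    push_cast; ring
  · refine list_prod_mulVec_mem _ _ (fun j hj => ?_) hv
    obtain ⟨i, hi, rfl⟩ := List.mem_drop_iff_getElem.1 hj
    simp only [List.length_finRange] at hi
    apply hfar <;> · simp [Fin.ext_iff]; try omega

end SwapInvariance

section AdjacentSwaps

variable {N n m : ℕ}

lemma symTensors_eq_iInf (N m : ℕ) :
    symTensors N (m + 1) = ⨅ k : Fin m, swapInvariants N k.castSucc k.succ := by
  refine le_antisymm (le_iInf fun k v hv f => hv _ f) fun v hv σ => ?_
  simp only [Submodule.mem_iInf] at hv
  have hσ : σ ∈ Submonoid.closure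
      (Set.range fun i : Fin m => Equiv.swap i.castSucc i.succ) := by
    rw [Equiv.Perm.mclosure_swap_castSucc_succ]; trivial
  induction hσ using Submonoid.closure_induction with
  | mem x hx =>
    obtain ⟨k, rfl⟩ := hx
    exact hv k
  | one => intro f; rfl
  | mul x y _ _ hx hy =>
    intro f
    rw [Equiv.Perm.coe_mul, ← Function.comp_assoc, hy, hx]

lemma swapInvariants_le_Jspan {a b : Fin n} (hab : a ≠ b) :
    swapInvariants N a b ≤ Jspan N n := by
  intro v hv
  refine Submodule.subset_span ⟨Equiv.swap a b, (1 / 2 : ℂ) • v, ?_⟩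
  funext f
  simp only [Pi.sub_apply, Pi.smul_apply, Equiv.Perm.sign_swap hab, smul_eq_mul, hv f]
  push_cast
  ring

lemma Jspan_eq_iSup (N m : ℕ) :
    Jspan N (m + 1) = ⨆ k : Fin m, swapInvariants N k.castSucc k.succ := by
  refine le_antisymm (Submodule.span_le.2 ?_)
    (iSup_le fun k => swapInvariants_le_Jspan (Fin.castSucc_lt_succ).ne)
  rintro _ ⟨σ, v, rfl⟩
  have hσ : σ ∈ Submonoid.closure
      (Set.range fun i : Fin m => Equiv.swap i.castSucc i.succ) := by
    rw [Equiv.Perm.mclosure_swap_castSucc_succ]; trivial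
  induction hσ using Submonoid.closure_induction generalizing v with
  | mem x hx =>
    obtain ⟨k, rfl⟩ := hx
    refine Submodule.mem_iSup_of_mem k fun f => ?_
    have hs : (f ∘ Equiv.swap k.castSucc k.succ) ∘ Equiv.swap k.castSucc k.succ = f := by
      funext c; simp
    simp only [Pi.sub_apply, Pi.smul_apply, Equiv.Perm.sign_swap (Fin.castSucc_lt_succ (i := k)).ne,
      smul_eq_mul, hs]
    push_cast
    ring
  | one => simp
  | mul x y _ _ hx hy =>
    have h := Submodule.add_mem _ (hx fun f => v (f ∘ y))
      (Submodule.smul_mem _ ((Equiv.Perm.sign x : ℤ) : ℂ) (hy v))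
    rw [SetLike.mem_coe]
    convert h using 1
    funext f
    simp only [Pi.sub_apply, Pi.add_apply, Pi.smul_apply, smul_eq_mul, Equiv.Perm.coe_mul,
      Function.comp_assoc, map_mul, Units.val_mul, Int.cast_mul]
    ring

lemma consSlice_mono {W W' : Submodule ℂ ((Fin n → Fin N) → ℂ)} (h : W ≤ W') :
    consSlice N n W ≤ consSlice N n W' :=
  fun _ hv i => h (hv i)

lemma consSlice_iInf {ι : Sort*} (W : ι → Submodule ℂ ((Fin n → Fin N) → ℂ)) :
    consSlice N n (⨅ k, W k) = ⨅ k, consSlice N n (W k) := by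
  ext v
  simp only [Submodule.mem_iInf]
  change (∀ i, _ ∈ ⨅ k, W k) ↔ ∀ k i, _ ∈ W k
  simp only [Submodule.mem_iInf]
  exact forall_comm

/-- The embedding `w ↦ e_i ⊗ w`. -/
def consTensor (N n : ℕ) (i : Fin N) :
    ((Fin n → Fin N) → ℂ) →ₗ[ℂ] ((Fin (n + 1) → Fin N) → ℂ) where
  toFun w f := if f 0 = i then w (Fin.tail f) else 0
  map_add' w w' := by
    funext f
    simp only [Pi.add_apply]
    split_ifs <;> simp
  map_smul' c w := by
    funext f
    simp

lemma consTensor_mem_consSlice {W : Submodule ℂ ((Fin n → Fin N) → ℂ)} (i : Fin N)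
    {w : (Fin n → Fin N) → ℂ} (hw : w ∈ W) : consTensor N n i w ∈ consSlice N n W := by
  intro j
  by_cases h : j = i
  · simpa [consTensor, h] using hw
  · simp only [consTensor, LinearMap.coe_mk, AddHom.coe_mk, Fin.cons_zero, if_neg h]
    exact W.zero_mem

lemma sum_consTensor (v : (Fin (n + 1) → Fin N) → ℂ) :
    ∑ i, consTensor N n i (fun g => v (Fin.cons i g)) = v := by
  funext f
  simp [consTensor, Finset.sum_apply]

lemma consSlice_iSup {ι : Sort*} (W : ι → Submodule ℂ ((Fin n → Fin N) → ℂ)) :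
    consSlice N n (⨆ k, W k) = ⨆ k, consSlice N n (W k) := by
  refine le_antisymm (fun v hv => ?_) (iSup_le fun k => consSlice_mono (le_iSup W k))
  rw [← sum_consTensor v]
  refine Submodule.sum_mem _ fun i _ => ?_
  have hle : (⨆ k, W k) ≤ (⨆ k, consSlice N n (W k)).comap (consTensor N n i) :=
    iSup_le fun k w hw => Submodule.mem_iSup_of_mem k (consTensor_mem_consSlice i hw)
  exact hle (hv i)

lemma cons_comp_swap (i : Fin N) (g : Fin n → Fin N) (a b : Fin n) :
    (Fin.cons i (g ∘ Equiv.swap a b) : Fin (n + 1) → Fin N) =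
      (Fin.cons i g : Fin (n + 1) → Fin N) ∘ Equiv.swap a.succ b.succ := by
  refine eq_comp_swap_iff.2 ⟨fun c ha hb => ?_, by simp, by simp⟩
  cases c using Fin.cases with
  | zero => rfl
  | succ c =>
    rw [Fin.cons_succ, Fin.cons_succ, Function.comp_apply, Equiv.swap_apply_of_ne_of_ne]
    · simpa using ha
    · simpa using hb

lemma consSlice_swapInvariants (a b : Fin n) :
    consSlice N n (swapInvariants N a b) = swapInvariants N a.succ b.succ := by
  ext v
  constructor
  · intro hv f
    have h := hv (f 0) (Fin.tail f)
    simpa only [cons_comp_swap, Fin.cons_self_tail] using h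
  · intro hv i g
    change v (Fin.cons i (g ∘ _)) = _
    rw [cons_comp_swap, hv]

end AdjacentSwaps

/-- the `L`-operator of `V^{⊗n}(w)` preserves `ℂ^N ⊗ S^n(ℂ^N)` and
`ℂ^N ⊗ J_n(ℂ^N)` wherever it is defined. -/
theorem L_preserves_sym_and_J (N : ℕ) (hN : 2 ≤ N) (τ : ℂ) (hτ : 0 < τ.im)
    (n : ℕ) (hn : 1 ≤ n) (z w γ : ℂ) (lam : Fin N → ℂ)
    (hz : ∀ k : ℕ, 1 ≤ k → k ≤ n → theta τ (z - w - (k : ℂ) * γ) ≠ 0)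
    (hlam : ∀ i j : Fin N, i ≠ j → ∀ c : ℤ, c.natAbs < n →
      theta τ (lam i - lam j + (c : ℂ) * γ) ≠ 0) :
    (∀ v ∈ consSlice N n (symTensors N n),
      (Lop N n τ γ z w lam).mulVec v ∈ consSlice N n (symTensors N n)) ∧
    (∀ v ∈ consSlice N n (Jspan N n),
      (Lop N n τ γ z w lam).mulVec v ∈ consSlice N n (Jspan N n)) := by
  obtain ⟨m, rfl⟩ := Nat.exists_eq_add_of_le' hn
  have hL := Lop_mulVec_mem_swapInvariants hτ z w γ lam hz hlam
  rw [symTensors_eq_iInf, Jspan_eq_iSup, consSlice_iInf, consSlice_iSup]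
  simp only [consSlice_swapInvariants]
  refine ⟨fun v hv => ?_, fun v hv => ?_⟩
  · rw [Submodule.mem_iInf] at hv ⊢
    exact fun k => hL k (hv k)
  · have hle : (⨆ k : Fin m, swapInvariants N k.castSucc.succ k.succ.succ) ≤
        (⨆ k : Fin m, swapInvariants N k.castSucc.succ k.succ.succ).comap
          (Lop N (m + 1) τ γ z w lam).mulVecLin :=
      iSup_le fun k v hv => Submodule.mem_iSup_of_mem k (hL k hv)
    exact hle hv

end EllipticQG
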